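/- Let q ∈ (0, 1/2), p₀ ∈ (0,1), and define the belief sequence by p_{n+1} = f_q(p_n) = p_n*q / (p_n*q + (1-p_n)*(1-q)). Then p_n → 0 as n → ∞; that is, when the observation model systematically disfavors the truth, repeated Bayesian updates drive the belief to 0. -/

import Mathlib

/-- A Bayesian update keeps the belief inside `(0, 1)`. -/
theorem bayes_update_mem_Ioo {p q : ℝ} (hp : p ∈ Set.Ioo 0 1) (hq : q ∈ Set.Ioo 0 1) :
    p * q / (p * q + (1 - p) * (1 - q)) ∈ Set.Ioo 0 1 := by
  have h₁ : 0 < p * q := mul_pos hp.1 hq.1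
  have h₂ : 0 < (1 - p) * (1 - q) := mul_pos (sub_pos.2 hp.2) (sub_pos.2 hq.2)
  exact ⟨by positivity, (div_lt_one (by positivity)).2 (by linarith)⟩

/-- A Bayesian update multiplies the odds of the belief by `q / (1 - q)`. -/
theorem bayes_update_odds {p q : ℝ} (hp : p ∈ Set.Ioo 0 1) (hq : q ∈ Set.Ioo 0 1) :
    p * q / (p * q + (1 - p) * (1 - q)) / (1 - p * q / (p * q + (1 - p) * (1 - q))) =
      p / (1 - p) * (q / (1 - q)) := by
  have h₁ : 0 < p * q := mul_pos hp.1 hq.1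
  have h₂ : 0 < (1 - p) * (1 - q) := mul_pos (sub_pos.2 hp.2) (sub_pos.2 hq.2)
  have hD : p * q + (1 - p) * (1 - q) ≠ 0 := by positivity
  rw [one_sub_div hD, add_sub_cancel_left, div_div_div_cancel_right₀ hD, div_mul_div_comm]

/-- With an observation model that systematically disfavors the truth, `q ∈ (0, 1/2)`,
repeated Bayesian updates drive the belief to `0`: `p_n → 0`. -/
theorem bayes_iterate_tendsto_zero (q p₀ : ℝ) (hq0 : 0 < q) (hq : q < 1 / 2)
    (hp0 : 0 < p₀) (hp1 : p₀ < 1) (p : ℕ → ℝ) (h0 : p 0 = p₀)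
    (hrec : ∀ n, p (n + 1) = p n * q / (p n * q + (1 - p n) * (1 - q))) :
    Filter.Tendsto p Filter.atTop (nhds 0) := by
  have hq_mem : q ∈ Set.Ioo 0 1 := ⟨hq0, by linarith⟩
  have hmem (n : ℕ) : p n ∈ Set.Ioo 0 1 := by
    induction n with
    | zero => exact h0 ▸ ⟨hp0, hp1⟩
    | succ n ih => exact hrec n ▸ bayes_update_mem_Ioo ih hq_mem
  have hodds (n : ℕ) : p n / (1 - p n) = p₀ / (1 - p₀) * (q / (1 - q)) ^ n := by
    induction n with
    | zero => simp [h0]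
    | succ n ih => rw [hrec, bayes_update_odds (hmem n) hq_mem, ih, pow_succ, mul_assoc]
  have hlim : Filter.Tendsto (fun n ↦ p₀ / (1 - p₀) * (q / (1 - q)) ^ n)
      Filter.atTop (nhds 0) := by
    have hq' : 0 < 1 - q := by linarith
    simpa using (tendsto_pow_atTop_nhds_zero_of_lt_one (by positivity)
      ((div_lt_one hq').2 (by linarith))).const_mul (p₀ / (1 - p₀))
  refine squeeze_zero (fun n ↦ (hmem n).1.le) (fun n ↦ ?_) hlim
  rw [← hodds n]
  obtain ⟨hpos, hlt⟩ := hmem n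
  exact le_div_self hpos.le (sub_pos.2 hlt) (by linarith)
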